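/- arXiv:2505.02281 — 3 statements merged into one kernel-verified Lean document; each statement's English description precedes it below -/
import Mathlib

section
/- Let f : E → ℝ be differentiable with L₁-Lipschitz gradient and β-strongly-γ-quasar-convex with respect to a global minimizer x* ∈ E. Then f satisfies the Polyak–Łojasiewicz inequality with parameter γ²β²/(4L₁): for every x ∈ E, (1/2)‖∇f(x)‖² ≥ (γ²β²/(4L₁))·(f(x) − f(x*)). -/
open scoped RealInnerProductSpace

/-- The descent lemma: a function with `L`-Lipschitz gradient is bounded above by its quadratic
model. -/
theorem le_add_inner_add_sq_of_lipschitz_gradient {F : Type*} [NormedAddCommGroup F]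
    [InnerProductSpace ℝ F] [CompleteSpace F] {f : F → ℝ} {L : ℝ} (hdiff : Differentiable ℝ f)
    (hlip : ∀ x y, ‖gradient f x - gradient f y‖ ≤ L * ‖x - y‖) (x y : F) :
    f y ≤ f x + ⟪gradient f x, y - x⟫ + L / 2 * ‖y - x‖ ^ 2 := by
  set v := y - x with hv
  let φ : ℝ → ℝ := fun t => f (x + t • v) - t * ⟪gradient f x, v⟫ - L / 2 * ‖v‖ ^ 2 * t ^ 2
  have hφ (t : ℝ) : HasDerivAt φ
      (⟪gradient f (x + t • v), v⟫ - ⟪gradient f x, v⟫ - L * ‖v‖ ^ 2 * t) t := by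
    have hline : HasDerivAt (fun t : ℝ => x + t • v) v t := by
      simpa using ((hasDerivAt_id t).smul_const v).const_add x
    have hf : HasDerivAt (fun t : ℝ => f (x + t • v)) ⟪gradient f (x + t • v), v⟫ t := by
      have h := (hdiff (x + t • v)).hasGradientAt.hasFDerivAt.comp_hasDerivAt t hline
      rwa [InnerProductSpace.toDual_apply_apply] at h
    refine ((hf.sub ((hasDerivAt_id t).mul_const ⟪gradient f x, v⟫)).sub
      ((hasDerivAt_pow 2 t).const_mul (L / 2 * ‖v‖ ^ 2))).congr_deriv ?_
    norm_num
    ring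
  have hanti : AntitoneOn φ (Set.Icc 0 1) := by
    refine antitoneOn_of_hasDerivWithinAt_nonpos (convex_Icc 0 1)
      (fun t _ => (hφ t).continuousAt.continuousWithinAt)
      (fun t _ => (hφ t).hasDerivWithinAt) fun t ht => ?_
    rw [interior_Icc] at ht
    rw [← inner_sub_left, sub_nonpos]
    calc ⟪gradient f (x + t • v) - gradient f x, v⟫
        ≤ ‖gradient f (x + t • v) - gradient f x‖ * ‖v‖ := real_inner_le_norm _ _
      _ ≤ L * ‖x + t • v - x‖ * ‖v‖ := by gcongr; exact hlip _ _
      _ = L * ‖v‖ ^ 2 * t := by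
        rw [add_sub_cancel_left, norm_smul, Real.norm_of_nonneg ht.1.le]
        ring
  have h := hanti (Set.left_mem_Icc.2 zero_le_one) (Set.right_mem_Icc.2 zero_le_one) zero_le_one
  simp only [φ, hv, one_smul, add_sub_cancel, zero_smul, add_zero] at h
  linarith

theorem strongly_quasar_convex_implies_PL
    (n : ℕ) (hn : 1 ≤ n)
    (f : EuclideanSpace ℝ (Fin n) → ℝ) (L₁ γ β : ℝ)
    (hL : 0 < L₁) (hγ0 : 0 < γ) (hγ1 : γ ≤ 1) (hβ : 0 < β)
    (hdiff : Differentiable ℝ f)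
    (hlip : ∀ x y, ‖gradient f x - gradient f y‖ ≤ L₁ * ‖x - y‖)
    (xstar : EuclideanSpace ℝ (Fin n))
    (hmin : ∀ x, f xstar ≤ f x)
    (hsqc : ∀ x, f xstar ≥ f x + (1 / γ) * ⟪gradient f x, xstar - x⟫
      + (β / 2) * ‖xstar - x‖ ^ 2) :
    ∀ x, (1 / 2) * ‖gradient f x‖ ^ 2 ≥
      (γ ^ 2 * β ^ 2 / (4 * L₁)) * (f x - f xstar) := by
  intro x
  have hgrad : gradient f xstar = 0 := by
    have hloc : IsLocalMin f xstar := Filter.Eventually.of_forall hmin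
    simp [gradient, hloc.fderiv_eq_zero]
  have hgap : f x - f xstar ≤ L₁ / 2 * ‖xstar - x‖ ^ 2 := by
    have h := le_add_inner_add_sq_of_lipschitz_gradient hdiff hlip xstar x
    rw [hgrad, inner_zero_left, norm_sub_rev] at h
    linarith
  have hbound : γ * β / 2 * ‖xstar - x‖ ≤ ‖gradient f x‖ := by
    rcases (norm_nonneg (xstar - x)).eq_or_lt with h0 | hpos
    · simp [← h0]
    · refine le_of_mul_le_mul_right ?_ hpos
      have hinner := neg_le_of_abs_le (abs_real_inner_le_norm (gradient f x) (xstar - x))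
      have h : β / 2 * ‖xstar - x‖ ^ 2 ≤ 1 / γ * (‖gradient f x‖ * ‖xstar - x‖) := by
        have := mul_le_mul_of_nonneg_left hinner (one_div_pos.2 hγ0).le
        linarith [hsqc x, hmin x]
      rw [one_div_mul_eq_div, le_div_iff₀ hγ0] at h
      linarith
  calc γ ^ 2 * β ^ 2 / (4 * L₁) * (f x - f xstar)
      ≤ γ ^ 2 * β ^ 2 / (4 * L₁) * (L₁ / 2 * ‖xstar - x‖ ^ 2) := by gcongr
    _ = 1 / 2 * (γ * β / 2 * ‖xstar - x‖) ^ 2 := by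
      field_simp
      ring
    _ ≤ 1 / 2 * ‖gradient f x‖ ^ 2 := by gcongr
end

section
/- Let f : E → ℝ be differentiable with L₁-Lipschitz gradient and β-strongly-γ-quasar-convex with respect to a global minimizer x* ∈ E. Then f satisfies the quadratic growth condition: for every x ∈ E, f(x) − f(x*) ≥ (γ²β²/(8L₁))·‖x − x*‖². -/
open scoped RealInnerProductSpace

/-- The descent lemma for a differentiable function with Lipschitz gradient. -/
theorem le_add_inner_gradient_add_sq {E : Type*} [NormedAddCommGroup E] [InnerProductSpace ℝ E]
    [CompleteSpace E] {f : E → ℝ} {L : ℝ} (hf : Differentiable ℝ f)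
    (hlip : ∀ x y, ‖gradient f x - gradient f y‖ ≤ L * ‖x - y‖) (x v : E) :
    f (x + v) ≤ f x + ⟪gradient f x, v⟫ + L / 2 * ‖v‖ ^ 2 := by
  let φ : ℝ → ℝ := fun t => f (x + t • v) - t * ⟪gradient f x, v⟫ - L / 2 * ‖v‖ ^ 2 * t ^ 2
  have hφ (t : ℝ) : HasDerivAt φ
      (⟪gradient f (x + t • v) - gradient f x, v⟫ - L * ‖v‖ ^ 2 * t) t := by
    have hline : HasDerivAt (fun s : ℝ => x + s • v) v t := by
      simpa using ((hasDerivAt_id t).smul_const v).const_add x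
    have hcomp := (hf (x + t • v)).hasGradientAt.hasFDerivAt.comp_hasDerivAt t hline
    rw [InnerProductSpace.toDual_apply_apply] at hcomp
    have h := (hcomp.sub ((hasDerivAt_id t).mul_const ⟪gradient f x, v⟫)).sub
      ((hasDerivAt_pow 2 t).const_mul (L / 2 * ‖v‖ ^ 2))
    refine h.congr_deriv ?_
    rw [inner_sub_left]
    push_cast
    ring
  have hanti : AntitoneOn φ (Set.Icc 0 1) := by
    refine antitoneOn_of_deriv_nonpos (convex_Icc 0 1)
      (fun t _ => (hφ t).continuousAt.continuousWithinAt)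
      (fun t _ => (hφ t).differentiableAt.differentiableWithinAt) fun t ht => ?_
    rw [interior_Icc] at ht
    have hgrad := hlip (x + t • v) x
    rw [add_sub_cancel_left, norm_smul, Real.norm_of_nonneg ht.1.le] at hgrad
    rw [(hφ t).deriv]
    nlinarith [real_inner_le_norm (gradient f (x + t • v) - gradient f x) v,
      mul_le_mul_of_nonneg_right hgrad (norm_nonneg v)]
  have h := hanti (Set.left_mem_Icc.2 zero_le_one) (Set.right_mem_Icc.2 zero_le_one) zero_le_one
  simp only [φ, one_smul, zero_smul, add_zero] at h
  linarith

theorem strongly_quasar_convex_implies_quadratic_growth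
    (n : ℕ) (hn : 1 ≤ n)
    (f : EuclideanSpace ℝ (Fin n) → ℝ) (L₁ γ β : ℝ)
    (hL : 0 < L₁) (hγ0 : 0 < γ) (hγ1 : γ ≤ 1) (hβ : 0 < β)
    (hdiff : Differentiable ℝ f)
    (hlip : ∀ x y, ‖gradient f x - gradient f y‖ ≤ L₁ * ‖x - y‖)
    (xstar : EuclideanSpace ℝ (Fin n))
    (hmin : ∀ x, f xstar ≤ f x)
    (hsqc : ∀ x, f xstar ≥ f x + (1 / γ) * ⟪gradient f x, xstar - x⟫
      + (β / 2) * ‖xstar - x‖ ^ 2) :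
    ∀ x, f x - f xstar ≥ (γ ^ 2 * β ^ 2 / (8 * L₁)) * ‖x - xstar‖ ^ 2 := by
  intro x
  set g := gradient f x with hg
  have hdesc : f xstar ≤ f x - ‖g‖ ^ 2 / (2 * L₁) := by
    have h := le_add_inner_gradient_add_sq hdiff hlip x (-(1 / L₁) • g)
    rw [← hg, inner_smul_right, real_inner_self_eq_norm_sq, norm_smul, norm_neg,
      Real.norm_of_nonneg (by positivity)] at h
    refine (hmin _).trans (h.trans_eq ?_)
    field_simp
    ring
  have hgrad : γ * β / 2 * ‖x - xstar‖ ≤ ‖g‖ := by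
    rcases (norm_nonneg (x - xstar)).eq_or_lt with h0 | hpos
    · simp [← h0]
    have hinner : (1 / γ) * ⟪g, xstar - x⟫ + (β / 2) * ‖xstar - x‖ ^ 2 ≤ 0 := by
      linarith [hsqc x, hmin x]
    have hmul : ⟪g, xstar - x⟫ + γ * β / 2 * ‖xstar - x‖ ^ 2 ≤ 0 := by
      have h := mul_nonpos_of_nonneg_of_nonpos hγ0.le hinner
      field_simp at h ⊢
      linarith
    have hcs := neg_le_of_abs_le (abs_real_inner_le_norm g (xstar - x))
    rw [norm_sub_rev xstar x] at hmul hcs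
    refine le_of_mul_le_mul_right ?_ hpos
    nlinarith
  have hsq : (γ * β / 2 * ‖x - xstar‖) ^ 2 ≤ ‖g‖ ^ 2 := by gcongr
  calc f x - f xstar ≥ ‖g‖ ^ 2 / (2 * L₁) := by linarith
    _ ≥ (γ * β / 2 * ‖x - xstar‖) ^ 2 / (2 * L₁) := by gcongr
    _ = (γ ^ 2 * β ^ 2 / (8 * L₁)) * ‖x - xstar‖ ^ 2 := by
      field_simp
      ring
end

section
/- Let f : E → ℝ be differentiable, l : E → ℝ ∪ {+∞} a proper convex function, F = f + l, a > 0, and p : E → E the proximal map of a·l, i.e., for every y ∈ E, p(y) minimizes z ↦ ‖z − y‖² + a·l(z) over E. Let 𝒳 ⊆ E, let x* ∈ 𝒳 be a minimizer of F over 𝒳, and suppose F is proximal β-strongly-γ-quasar-convex on 𝒳 at parameter a with respect to x*: with Q(x) = (1/a)(x − p(x − a∇f(x))), F(x*) − F(x) ≥ (1/γ)⟨Q(x), x* − x⟩ + (β/2)‖x − x*‖² for all x ∈ 𝒳. Then the proximal error bound holds: for every x ∈ 𝒳, ‖x − x*‖ ≤ (2/(aβγ))·‖p(x − a∇f(x))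 − x‖. -/
open scoped RealInnerProductSpace

theorem strong_proximal_quasar_convex_implies_proximal_error_bound
    (n : ℕ) (hn : 1 ≤ n)
    (f : EuclideanSpace ℝ (Fin n) → ℝ) (γ β a : ℝ)
    (hγ0 : 0 < γ) (hγ1 : γ ≤ 1) (hβ : 0 < β) (ha : 0 < a)
    (hdiff : Differentiable ℝ f)
    -- l is a proper convex function with values in ℝ ∪ {+∞}
    (l : EuclideanSpace ℝ (Fin n) → EReal)
    (hl_ne_bot : ∀ x, l x ≠ ⊥)
    (hl_proper : ∃ x, l x ≠ ⊤)
    (hl_convex : ∀ x y : EuclideanSpace ℝ (Fin n), ∀ s : ℝ, 0 ≤ s → s ≤ 1 →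
      l (s • x + (1 - s) • y) ≤ (s : EReal) * l x + ((1 - s : ℝ) : EReal) * l y)
    -- F = f + l
    (F : EuclideanSpace ℝ (Fin n) → EReal)
    (hF : ∀ x, F x = (f x : EReal) + l x)
    -- p is the proximal map of a·l
    (p : EuclideanSpace ℝ (Fin n) → EuclideanSpace ℝ (Fin n))
    (hp : ∀ y z, ((‖p y - y‖ ^ 2 : ℝ) : EReal) + (a : EReal) * l (p y) ≤
      ((‖z - y‖ ^ 2 : ℝ) : EReal) + (a : EReal) * l z)
    -- xstar minimizes F over 𝒳
    (𝒳 : Set (EuclideanSpace ℝ (Fin n)))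
    (xstar : EuclideanSpace ℝ (Fin n)) (hxstar : xstar ∈ 𝒳)
    (hmin : ∀ x ∈ 𝒳, F xstar ≤ F x)
    -- F is proximal β-strongly-γ-quasar-convex on 𝒳 at parameter a w.r.t. xstar
    (hsqc : ∀ x ∈ 𝒳, F xstar - F x ≥
      (((1 / γ) * ⟪(1 / a) • (x - p (x - a • gradient f x)), xstar - x⟫
        + (β / 2) * ‖x - xstar‖ ^ 2 : ℝ) : EReal)) :
    ∀ x ∈ 𝒳, ‖x - xstar‖ ≤ (2 / (a * β * γ)) * ‖p (x - a • gradient f x) - x‖ := by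
  intro x hx
  have h := (hsqc x hx).trans ((EReal.sub_le_sub (hmin x hx) le_rfl).trans EReal.sub_self_le_zero)
  rw [← EReal.coe_zero, EReal.coe_le_coe_iff, real_inner_smul_left] at h
  set q := p (x - a • gradient f x)
  have hcs : -(‖q - x‖ * ‖x - xstar‖) ≤ ⟪x - q, xstar - x⟫ := by
    rw [norm_sub_rev q x, norm_sub_rev x xstar]
    exact neg_le_of_abs_le (abs_real_inner_le_norm _ _)
  have hquad : a * β * γ * ‖x - xstar‖ ^ 2 ≤ 2 * ‖q - x‖ * ‖x - xstar‖ := by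
    have hscale := mul_le_mul_of_nonneg_left h (by positivity : 0 ≤ 2 * a * γ)
    field_simp at hscale
    nlinarith
  rw [div_mul_eq_mul_div, le_div_iff₀ (by positivity)]
  rcases (norm_nonneg (x - xstar)).eq_or_lt with h0 | hpos
  · rw [← h0, zero_mul]
    positivity
  · refine le_of_mul_le_mul_right ?_ hpos
    linarith
end
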